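/- arXiv:2004.03644 — 3 statements merged into one kernel-verified Lean document; each statement's English description precedes it below -/
import Mathlib

section
/- Adjustment-set exchange identity (core probabilistic step in the proof of the Relational Adjustment Formula): fix a treatment value t and an outcome value y, and assume (i) Y is conditionally independent of W given (T, Z), (ii) Z is conditionally independent of T given W, and (iii) Pr(T = t ∧ Z = z ∧ W = w) > 0 for every z and w. Then adjusting for W and adjusting for Z give the same answer: Σ_w Pr(Y = y | W = w, T = t) · Pr(W = w) = Σ_z Pr(Y = y | Z = z, T = t) · Pr(Z = z), where the sums range over all values of the finite types of W and Z respectively. -/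
open Finset
open scoped Classical

/-- Probability of the event `A` under the finite probability mass function `p`. -/
noncomputable def prob {Ω : Type*} [Fintype Ω] (p : Ω → ℝ) (A : Ω → Prop) : ℝ :=
  ∑ ω : Ω, if A ω then p ω else 0

/-- Conditional probability `Pr(A | B) = Pr(A ∩ B) / Pr(B)`. -/
noncomputable def condProb {Ω : Type*} [Fintype Ω] (p : Ω → ℝ) (A B : Ω → Prop) : ℝ :=
  prob p (fun ω => A ω ∧ B ω) / prob p B

theorem prob_congr' {Ω : Type*} [Fintype Ω] (p : Ω → ℝ) {A B : Ω → Prop}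
    (h : ∀ ω, A ω ↔ B ω) : prob p A = prob p B := by
  have : A = B := funext fun ω => propext (h ω)
  rw [this]

theorem prob_split {Ω ι : Type*} [Fintype Ω] [Fintype ι] (p : Ω → ℝ) (A : Ω → Prop)
    (Z : Ω → ι) : prob p A = ∑ z : ι, prob p (fun ω => A ω ∧ Z ω = z) := by
  unfold prob
  rw [Finset.sum_comm]
  refine Finset.sum_congr rfl fun ω _ => ?_
  by_cases h : A ω <;> simp [h]

theorem prob_mono' {Ω : Type*} [Fintype Ω] (p : Ω → ℝ) (hp0 : ∀ ω, 0 ≤ p ω)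
    {A B : Ω → Prop} (h : ∀ ω, A ω → B ω) : prob p A ≤ prob p B := by
  unfold prob
  refine Finset.sum_le_sum fun ω _ => ?_
  by_cases hA : A ω
  · simp [hA, h ω hA]
  · by_cases hB : B ω <;> simp [hA, hB, hp0 ω]

/-- Adjustment-set exchange identity: if `Y ⫫ W | (T, Z)` and `Z ⫫ T | W`, and all joint
events `T = t ∧ Z = z ∧ W = w` have positive probability, then adjusting for `W` and
adjusting for `Z` give the same answer:
`Σ_w Pr(Y = y | W = w, T = t)·Pr(W = w) = Σ_z Pr(Y = y | Z = z, T = t)·Pr(Z = z)`. -/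
theorem adjustment_exchange {Ω 𝒴 𝒯 𝒵 𝒲 : Type*}
    [Fintype Ω] [Fintype 𝒴] [Fintype 𝒯] [Fintype 𝒵] [Fintype 𝒲]
    (p : Ω → ℝ) (hp0 : ∀ ω, 0 ≤ p ω) (hp1 : ∑ ω : Ω, p ω = 1)
    (Y : Ω → 𝒴) (T : Ω → 𝒯) (Z : Ω → 𝒵) (W : Ω → 𝒲)
    (t : 𝒯) (y : 𝒴)
    (hYW : ∀ (y' : 𝒴) (t' : 𝒯) (z : 𝒵) (w : 𝒲),
      0 < prob p (fun ω => T ω = t' ∧ Z ω = z ∧ W ω = w) →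
      condProb p (fun ω => Y ω = y') (fun ω => T ω = t' ∧ Z ω = z ∧ W ω = w)
        = condProb p (fun ω => Y ω = y') (fun ω => T ω = t' ∧ Z ω = z))
    (hZT : ∀ (z : 𝒵) (t' : 𝒯) (w : 𝒲),
      0 < prob p (fun ω => W ω = w ∧ T ω = t') →
      condProb p (fun ω => Z ω = z) (fun ω => W ω = w ∧ T ω = t')
        = condProb p (fun ω => Z ω = z) (fun ω => W ω = w))
    (hpos : ∀ (z : 𝒵) (w : 𝒲), 0 < prob p (fun ω => T ω = t ∧ Z ω = z ∧ W ω = w)) :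
    ∑ w : 𝒲, condProb p (fun ω => Y ω = y) (fun ω => W ω = w ∧ T ω = t)
        * prob p (fun ω => W ω = w)
      = ∑ z : 𝒵, condProb p (fun ω => Y ω = y) (fun ω => Z ω = z ∧ T ω = t)
        * prob p (fun ω => Z ω = z) := by
  have key : ∀ z w, prob p (fun ω => (Y ω = y ∧ W ω = w ∧ T ω = t) ∧ Z ω = z)
      / prob p (fun ω => W ω = w ∧ T ω = t) * prob p (fun ω => W ω = w)
      = condProb p (fun ω => Y ω = y) (fun ω => Z ω = z ∧ T ω = t)
        * prob p (fun ω => Z ω = z ∧ W ω = w) := by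
    intro z w
    have h0 := hpos z w
    have h1 : 0 < prob p (fun ω => W ω = w ∧ T ω = t) :=
      h0.trans_le (prob_mono' p hp0 fun ω h => ⟨h.2.2, h.1⟩)
    have h2 : 0 < prob p (fun ω => W ω = w) :=
      h0.trans_le (prob_mono' p hp0 fun ω h => h.2.2)
    have e1 := hYW y t z w h0
    have e2 := hZT z t w h1
    have e3 : condProb p (fun ω => Y ω = y) (fun ω => Z ω = z ∧ T ω = t)
        = condProb p (fun ω => Y ω = y) (fun ω => T ω = t ∧ Z ω = z) := by
      unfold condProb
      congr 1 <;> exact prob_congr' p fun ω => by tauto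
    rw [e3, ← e1]
    unfold condProb at e2 ⊢
    rw [prob_congr' p (B := fun ω => T ω = t ∧ Z ω = z ∧ W ω = w)
      (fun ω => by tauto)] at e2
    rw [prob_congr' p (A := fun ω => (Y ω = y ∧ W ω = w ∧ T ω = t) ∧ Z ω = z)
      (B := fun ω => Y ω = y ∧ T ω = t ∧ Z ω = z ∧ W ω = w) (fun ω => by tauto)]
    rw [div_eq_div_iff h1.ne' h2.ne'] at e2
    rw [div_mul_eq_mul_div, div_mul_eq_mul_div, div_eq_div_iff h1.ne' h0.ne']
    rw [mul_assoc, mul_assoc, mul_comm (prob p fun ω => W ω = w), e2]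
  calc _ = ∑ w : 𝒲, ∑ z : 𝒵, condProb p (fun ω => Y ω = y) (fun ω => Z ω = z ∧ T ω = t)
        * prob p (fun ω => Z ω = z ∧ W ω = w) := by
        refine Finset.sum_congr rfl fun w _ => ?_
        rw [condProb, prob_split p (fun ω => Y ω = y ∧ W ω = w ∧ T ω = t) Z,
          Finset.sum_div, Finset.sum_mul]
        exact Finset.sum_congr rfl fun z _ => key z w
    _ = _ := by
        rw [Finset.sum_comm]
        refine Finset.sum_congr rfl fun z _ => ?_
        rw [← Finset.mul_sum, ← prob_split p (fun ω => Z ω = z) W]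
end

section
/- Adjustment-set exchange identity for conditional expectations: fix a treatment value t, and assume (i) Y is conditionally independent of W given (T, Z), (ii) Z is conditionally independent of T given W, and (iii) Pr(T = t ∧ Z = z ∧ W = w) > 0 for every z and w. Then Σ_w E[Y | W = w, T = t] · Pr(W = w) = Σ_z E[Y | Z = z, T = t] · Pr(Z = z), where the sums range over all values of the finite types of W and Z respectively, and E[Y | B] denotes the expectation of Y with respect to the conditional probability measure Pr(· | B). -/
open Finset
open scoped Classical

/-- Conditional expectation `E[Y | B] = Σ_y y · Pr(Y = y | B)`, where the sum ranges over
the (finitely many) values taken by the real-valued random variable `Y`. -/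
noncomputable def condExp {Ω : Type*} [Fintype Ω] (p : Ω → ℝ) (Y : Ω → ℝ) (B : Ω → Prop) : ℝ :=
  ∑ y ∈ Finset.image Y Finset.univ, y * condProb p (fun ω => Y ω = y) B

theorem prob_split_aux {Ω 𝒵 : Type*} [Fintype Ω] [Fintype 𝒵] (p : Ω → ℝ) (Z : Ω → 𝒵)
    (A : Ω → Prop) : prob p A = ∑ z : 𝒵, prob p (fun ω => Z ω = z ∧ A ω) := by
  unfold prob
  rw [Finset.sum_comm]
  refine Finset.sum_congr rfl fun ω _ => ?_
  by_cases h : A ω <;> simp [h]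

theorem prob_mono_aux {Ω : Type*} [Fintype Ω] (p : Ω → ℝ) (hp0 : ∀ ω, 0 ≤ p ω)
    (A B : Ω → Prop) (h : ∀ ω, A ω → B ω) : prob p A ≤ prob p B := by
  unfold prob
  refine Finset.sum_le_sum fun ω _ => ?_
  by_cases hA : A ω
  · simp [hA, h ω hA]
  · by_cases hB : B ω <;> simp [hA, hB, hp0 ω]

theorem prob_congr_aux {Ω : Type*} [Fintype Ω] (p : Ω → ℝ)
    (A B : Ω → Prop) (h : ∀ ω, A ω ↔ B ω) : prob p A = prob p B := by
  have : A = B := funext fun ω => propext (h ω)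
  rw [this]

/-- Adjustment-set exchange identity for conditional expectations: if `Y ⫫ W | (T, Z)` and
`Z ⫫ T | W`, and all joint events `T = t ∧ Z = z ∧ W = w` have positive probability, then
`Σ_w E[Y | W = w, T = t]·Pr(W = w) = Σ_z E[Y | Z = z, T = t]·Pr(Z = z)`. -/
theorem adjustment_exchange_condExp {Ω 𝒯 𝒵 𝒲 : Type*}
    [Fintype Ω] [Fintype 𝒯] [Fintype 𝒵] [Fintype 𝒲]
    (p : Ω → ℝ) (hp0 : ∀ ω, 0 ≤ p ω) (hp1 : ∑ ω : Ω, p ω = 1)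
    (Y : Ω → ℝ) (T : Ω → 𝒯) (Z : Ω → 𝒵) (W : Ω → 𝒲)
    (t : 𝒯)
    (hYW : ∀ (y' : ℝ) (t' : 𝒯) (z : 𝒵) (w : 𝒲),
      0 < prob p (fun ω => T ω = t' ∧ Z ω = z ∧ W ω = w) →
      condProb p (fun ω => Y ω = y') (fun ω => T ω = t' ∧ Z ω = z ∧ W ω = w)
        = condProb p (fun ω => Y ω = y') (fun ω => T ω = t' ∧ Z ω = z))
    (hZT : ∀ (z : 𝒵) (t' : 𝒯) (w : 𝒲),
      0 < prob p (fun ω => W ω = w ∧ T ω = t') →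
      condProb p (fun ω => Z ω = z) (fun ω => W ω = w ∧ T ω = t')
        = condProb p (fun ω => Z ω = z) (fun ω => W ω = w))
    (hpos : ∀ (z : 𝒵) (w : 𝒲), 0 < prob p (fun ω => T ω = t ∧ Z ω = z ∧ W ω = w)) :
    ∑ w : 𝒲, condExp p Y (fun ω => W ω = w ∧ T ω = t) * prob p (fun ω => W ω = w)
      = ∑ z : 𝒵, condExp p Y (fun ω => Z ω = z ∧ T ω = t) * prob p (fun ω => Z ω = z) := by
  have hne : Nonempty Ω := by
    by_contra hn
    rw [not_nonempty_iff] at hn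
    simp at hp1
  obtain ⟨ω₀⟩ := hne
  have key : ∀ y w, condProb p (fun ω => Y ω = y) (fun ω => W ω = w ∧ T ω = t)
      * prob p (fun ω => W ω = w)
      = ∑ z : 𝒵, condProb p (fun ω => Y ω = y) (fun ω => Z ω = z ∧ T ω = t)
        * prob p (fun ω => W ω = w ∧ Z ω = z) := by
    intro y w
    have hwt : 0 < prob p (fun ω => W ω = w ∧ T ω = t) :=
      (hpos (Z ω₀) w).trans_le (prob_mono_aux p hp0 _ _ fun ω h => ⟨h.2.2, h.1⟩)
    have hw : 0 < prob p (fun ω => W ω = w) :=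
      hwt.trans_le (prob_mono_aux p hp0 _ _ fun ω h => h.1)
    rw [condProb, prob_split_aux p Z (fun ω => Y ω = y ∧ W ω = w ∧ T ω = t),
      Finset.sum_div, Finset.sum_mul]
    refine Finset.sum_congr rfl fun z _ => ?_
    have h1 := hYW y t z w (hpos z w)
    have h2 := hZT z t w hwt
    have e1 : condProb p (fun ω => Y ω = y) (fun ω => Z ω = z ∧ T ω = t)
        = condProb p (fun ω => Y ω = y) (fun ω => T ω = t ∧ Z ω = z) := by
      have : (fun ω => Z ω = z ∧ T ω = t) = (fun ω => T ω = t ∧ Z ω = z) :=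
        funext fun ω => propext and_comm
      rw [this]
    rw [e1, ← h1]
    have hp := hpos z w
    unfold condProb at h2 ⊢
    rw [prob_congr_aux p (fun ω => Z ω = z ∧ W ω = w ∧ T ω = t)
        (fun ω => T ω = t ∧ Z ω = z ∧ W ω = w) (fun ω => by tauto),
      prob_congr_aux p (fun ω => Z ω = z ∧ W ω = w)
        (fun ω => W ω = w ∧ Z ω = z) (fun ω => by tauto),
      div_eq_div_iff hwt.ne' hw.ne'] at h2
    rw [prob_congr_aux p (fun ω => Z ω = z ∧ Y ω = y ∧ W ω = w ∧ T ω = t)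
        (fun ω => Y ω = y ∧ T ω = t ∧ Z ω = z ∧ W ω = w) (fun ω => by tauto),
      div_mul_eq_mul_div, div_mul_eq_mul_div, div_eq_div_iff hwt.ne' hp.ne']
    linear_combination (prob p (fun ω => Y ω = y ∧ T ω = t ∧ Z ω = z ∧ W ω = w)) * h2
  simp only [condExp, Finset.sum_mul]
  rw [Finset.sum_comm, Finset.sum_comm (s := (Finset.univ : Finset 𝒵))]
  refine Finset.sum_congr rfl fun y _ => ?_
  simp only [mul_assoc, key]
  rw [← Finset.mul_sum, ← Finset.mul_sum, Finset.sum_comm]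
  congr 1
  refine Finset.sum_congr rfl fun z _ => ?_
  rw [← Finset.mul_sum, ← prob_split_aux p W (fun ω => Z ω = z)]
end

section
/- Conditional mixture identity: fix values t of T, w of W, and y of Y, and assume (i) Y is conditionally independent of W given (T, Z), (ii) Z is conditionally independent of T given W, and (iii) Pr(T = t ∧ Z = z ∧ W = w) > 0 for every value z of Z. Then Pr(Y = y | W = w, T = t) = Σ_z Pr(Y = y | T = t, Z = z) · Pr(Z = z | W = w), where the sum ranges over all values z of the finite type of Z. -/
open Finset
open scoped Classical

/-- Conditional mixture identity: if `Y ⫫ W | (T, Z)` and `Z ⫫ T | W`, and all joint events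
`T = t ∧ Z = z ∧ W = w` (for the fixed `t`, `w`) have positive probability, then
`Pr(Y = y | W = w, T = t) = Σ_z Pr(Y = y | T = t, Z = z) · Pr(Z = z | W = w)`. -/
theorem condProb_mixture {Ω 𝒴 𝒯 𝒵 𝒲 : Type*}
    [Fintype Ω] [Fintype 𝒴] [Fintype 𝒯] [Fintype 𝒵] [Fintype 𝒲]
    (p : Ω → ℝ) (hp0 : ∀ ω, 0 ≤ p ω) (hp1 : ∑ ω : Ω, p ω = 1)
    (Y : Ω → 𝒴) (T : Ω → 𝒯) (Z : Ω → 𝒵) (W : Ω → 𝒲)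
    (t : 𝒯) (w : 𝒲) (y : 𝒴)
    (hYW : ∀ (y' : 𝒴) (t' : 𝒯) (z : 𝒵) (w' : 𝒲),
      0 < prob p (fun ω => T ω = t' ∧ Z ω = z ∧ W ω = w') →
      condProb p (fun ω => Y ω = y') (fun ω => T ω = t' ∧ Z ω = z ∧ W ω = w')
        = condProb p (fun ω => Y ω = y') (fun ω => T ω = t' ∧ Z ω = z))
    (hZT : ∀ (z : 𝒵) (t' : 𝒯) (w' : 𝒲),
      0 < prob p (fun ω => W ω = w' ∧ T ω = t') →
      condProb p (fun ω => Z ω = z) (fun ω => W ω = w' ∧ T ω = t')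
        = condProb p (fun ω => Z ω = z) (fun ω => W ω = w'))
    (hpos : ∀ (z : 𝒵), 0 < prob p (fun ω => T ω = t ∧ Z ω = z ∧ W ω = w)) :
    condProb p (fun ω => Y ω = y) (fun ω => W ω = w ∧ T ω = t)
      = ∑ z : 𝒵, condProb p (fun ω => Y ω = y) (fun ω => T ω = t ∧ Z ω = z)
          * condProb p (fun ω => Z ω = z) (fun ω => W ω = w) := by
  have hdec : ∀ A : Ω → Prop, prob p A = ∑ z : 𝒵, prob p (fun ω => A ω ∧ Z ω = z) := by
    intro A
    unfold prob
    rw [Finset.sum_comm]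
    refine Finset.sum_congr rfl fun ω _ => ?_
    by_cases h : A ω <;> simp [h]
  have hcongr : ∀ A B : Ω → Prop, (∀ ω, A ω ↔ B ω) → prob p A = prob p B := by
    intro A B h
    have : A = B := funext fun ω => propext (h ω)
    rw [this]
  have hne : Nonempty Ω := by
    by_contra hcon
    rw [not_nonempty_iff] at hcon
    simp at hp1
  obtain ⟨ω₀⟩ := hne
  have hWT : 0 < prob p (fun ω => W ω = w ∧ T ω = t) := by
    rw [hdec]
    refine Finset.sum_pos (fun z _ => ?_) ⟨Z ω₀, Finset.mem_univ _⟩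
    rw [hcongr _ (fun ω => T ω = t ∧ Z ω = z ∧ W ω = w) (fun ω => by tauto)]
    exact hpos z
  have key : ∀ z : 𝒵, condProb p (fun ω => Y ω = y) (fun ω => T ω = t ∧ Z ω = z)
      * condProb p (fun ω => Z ω = z) (fun ω => W ω = w)
      = prob p (fun ω => (Y ω = y ∧ W ω = w ∧ T ω = t) ∧ Z ω = z)
        / prob p (fun ω => W ω = w ∧ T ω = t) := by
    intro z
    rw [← hYW y t z w (hpos z), ← hZT z t w hWT]
    unfold condProb
    rw [hcongr (fun ω => Z ω = z ∧ W ω = w ∧ T ω = t)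
        (fun ω => T ω = t ∧ Z ω = z ∧ W ω = w) (fun ω => by tauto),
      hcongr (fun ω => (Y ω = y ∧ W ω = w ∧ T ω = t) ∧ Z ω = z)
        (fun ω => Y ω = y ∧ T ω = t ∧ Z ω = z ∧ W ω = w) (fun ω => by tauto)]
    exact div_mul_div_cancel₀ (hpos z).ne'
  rw [Finset.sum_congr rfl fun z _ => key z, ← Finset.sum_div, ← hdec]
  rfl
end
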